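/- arXiv:1810.12102 — 4 statements merged into one kernel-verified Lean document; each statement's English description precedes it below -/
import Mathlib

section
/- Let n be a positive odd integer and let x be an integer with gcd(x(1−x), n) = 1. Then (−1)^{#{k : 1 ≤ k < n/2, {kx}_n < n/2 and {k(1−x)}_n < n/2}} = ((2x(x−1))/n), where (·/n) is the Jacobi symbol. -/
open Finset

/-- The sum of `⌊k a / n⌋` over the positive integers `k ≤ n / 2`. -/
def halfFloorSum (a : ℤ) (n : ℕ) : ℤ :=
  ∑ k ∈ Ico 1 (n / 2 + 1), ((k : ℤ) * a) / (n : ℤ)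

theorem halfFloorSum_add_mul (a c : ℤ) {n : ℕ} (hn : 0 < n) :
    halfFloorSum (a + c * n) n = halfFloorSum a n + c * ∑ k ∈ Ico 1 (n / 2 + 1), (k : ℤ) := by
  have hn' : (n : ℤ) ≠ 0 := by exact_mod_cast hn.ne'
  rw [halfFloorSum, halfFloorSum, mul_sum, ← sum_add_distrib]
  refine sum_congr rfl fun k _ => ?_
  rw [show (k : ℤ) * (a + c * n) = k * a + c * k * n by ring, Int.add_mul_ediv_right _ _ hn']

theorem not_dvd_natCast_mul {a : ℤ} {n k : ℕ} (h : Int.gcd a n = 1) (hk : 0 < k) (hkn : k < n) :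
    ¬ (n : ℤ) ∣ k * a := by
  intro hd
  have := Int.dvd_of_dvd_mul_left_of_gcd_one hd (by rwa [Int.gcd_comm])
  exact Nat.not_dvd_of_pos_of_lt hk hkn (Int.natCast_dvd_natCast.mp this)

theorem emod_natCast_mul_pos {a : ℤ} {n k : ℕ} (h : Int.gcd a n = 1) (hk : 0 < k) (hkn : k < n) :
    0 < ((k : ℤ) * a) % n := by
  have h0 := Int.emod_nonneg ((k : ℤ) * a) (show (n : ℤ) ≠ 0 by omega)
  have h1 := mt Int.dvd_of_emod_eq_zero (not_dvd_natCast_mul h hk hkn)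
  omega

theorem halfFloorSum_neg {a : ℤ} {n : ℕ} (h : Int.gcd a n = 1) :
    halfFloorSum (-a) n = -halfFloorSum a n - (n / 2 : ℕ) := by
  have hcard : ((n / 2 : ℕ) : ℤ) = ∑ k ∈ Ico 1 (n / 2 + 1), (1 : ℤ) := by simp
  rw [hcard, halfFloorSum, halfFloorSum, ← sum_neg_distrib, ← sum_sub_distrib]
  refine sum_congr rfl fun k hk => ?_
  rw [mem_Ico] at hk
  have hn : (0 : ℤ) < n := by omega
  have hp := emod_natCast_mul_pos h (by omega : 0 < k) (by omega)
  have hl := Int.emod_lt_of_pos ((k : ℤ) * a) hn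
  have hd := Int.mul_ediv_add_emod ((k : ℤ) * a) n
  rw [Int.ediv_eq_iff_of_pos hn]
  constructor <;> linarith

theorem sum_mul_div_eq_card_filter (p q : ℕ) :
    ∑ a ∈ Ico 1 (p / 2 + 1), a * q / p =
      #{x ∈ Ico 1 (p / 2 + 1) ×ˢ Ico 1 (q / 2 + 1) | x.2 * p ≤ x.1 * q} := by
  rcases Nat.eq_zero_or_pos p with rfl | hp
  · simp
  calc
    _ = ∑ a ∈ Ico 1 (p / 2 + 1), #{x ∈ Ico 1 (q / 2 + 1) | x * p ≤ a * q} := by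
      refine sum_congr rfl fun a ha => ZMod.div_eq_filter_card hp ?_
      calc
        a * q / p ≤ p / 2 * q / p := by
          have := Nat.le_of_lt_succ (mem_Ico.mp ha).2
          gcongr
        _ ≤ _ := Nat.div_mul_div_le_div _ _ _
    _ = _ := by simp only [card_eq_sum_ones, sum_filter, sum_product]

theorem sum_mul_div_add_sum_mul_div_of_coprime {p q : ℕ} (h : p.Coprime q) :
    ∑ a ∈ Ico 1 (p / 2 + 1), a * q / p + ∑ a ∈ Ico 1 (q / 2 + 1), a * p / q =
      p / 2 * (q / 2) := by
  have hswap :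
      #{x ∈ Ico 1 (q / 2 + 1) ×ˢ Ico 1 (p / 2 + 1) | x.2 * q ≤ x.1 * p} =
        #{x ∈ Ico 1 (p / 2 + 1) ×ˢ Ico 1 (q / 2 + 1) | ¬ x.2 * p ≤ x.1 * q} := by
    refine card_equiv (Equiv.prodComm _ _) fun ⟨y, x⟩ => ?_
    simp only [mem_filter, mem_product, Equiv.prodComm_apply, Prod.swap_prod_mk, not_le]
    rw [and_comm (a := y ∈ _)]
    refine and_congr_right fun hxy => ?_
    rw [mem_Ico, mem_Ico] at hxy
    refine ⟨fun hle => lt_of_le_of_ne hle fun heq => ?_, le_of_lt⟩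
    have : p ∣ x := h.dvd_of_dvd_mul_right ⟨y, by rw [heq, mul_comm]⟩
    exact Nat.not_dvd_of_pos_of_lt (by omega) (by omega) this
  rw [sum_mul_div_eq_card_filter, sum_mul_div_eq_card_filter, hswap,
    card_filter_add_card_filter_not, card_product]
  simp

theorem halfFloorSum_add_halfFloorSum {p q : ℕ} (h : p.Coprime q) :
    halfFloorSum q p + halfFloorSum p q = ((p / 2 * (q / 2) : ℕ) : ℤ) := by
  rw [← sum_mul_div_add_sum_mul_div_of_coprime h]
  simp [halfFloorSum]

theorem sum_Ico_one_half_mul_two (n : ℕ) :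
    (∑ k ∈ Ico 1 (n / 2 + 1), k) * 2 = (n / 2 + 1) * (n / 2) := by
  have h := sum_range_id_mul_two (n / 2 + 1)
  rwa [range_eq_Ico, sum_eq_sum_Ico_succ_bot (by omega), zero_add, Nat.add_sub_cancel] at h

theorem jacobiSym_neg_eq_negOnePow {n : ℕ} (hn : Odd n) (a : ℤ) :
    jacobiSym (-a) n = ((n / 2 : ℕ) : ℤ).negOnePow * jacobiSym a n := by
  rw [jacobiSym.neg a hn, ZMod.χ₄_eq_neg_one_pow (Nat.odd_iff.mp hn),
    Int.coe_negOnePow_natCast]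

theorem jacobiSym_two_eq_negOnePow {n : ℕ} (hn : Odd n) :
    jacobiSym 2 n = (∑ k ∈ Ico 1 (n / 2 + 1), (k : ℤ)).negOnePow := by
  have hs := sum_Ico_one_half_mul_two n
  rw [← Nat.cast_sum, jacobiSym.at_two hn, ZMod.χ₈_nat_eq_if_mod_eight]
  generalize ∑ k ∈ Ico 1 (n / 2 + 1), k = s at hs ⊢
  obtain ⟨m, rfl⟩ := hn
  rw [show (2 * m + 1) / 2 = m by omega] at hs
  have hs4 : (s * 2) % 4 = ((m % 4 + 1) * (m % 4)) % 4 := by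
    rw [hs]; simp [Nat.mul_mod, Nat.add_mod]
  rw [if_neg (by omega)]
  have hm : m % 4 < 4 := Nat.mod_lt _ (by norm_num)
  split_ifs with h8
  · have : m % 4 = 0 ∨ m % 4 = 3 := by omega
    rw [Int.negOnePow_even]
    · rfl
    · rcases this with h | h <;> rw [h] at hs4 <;> exact Int.even_iff.mpr (by omega)
  · have : m % 4 = 1 ∨ m % 4 = 2 := by omega
    rw [Int.negOnePow_odd]
    · rfl
    · rcases this with h | h <;> rw [h] at hs4 <;> exact Int.odd_iff.mpr (by omega)

theorem negOnePow_halfFloorSum_neg {a : ℤ} {n : ℕ} (hn : Odd n) (h : Int.gcd a n = 1)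
    (ha : ((halfFloorSum a n).negOnePow : ℤ) = jacobiSym a n) :
    ((halfFloorSum (-a) n).negOnePow : ℤ) = jacobiSym (-a) n := by
  rw [halfFloorSum_neg h, jacobiSym_neg_eq_negOnePow hn, ← ha, Int.negOnePow_sub, Int.negOnePow_neg,
    Units.val_mul, mul_comm]

theorem negOnePow_halfFloorSum_add_two_mul {a : ℤ} {n : ℕ} (hn : 0 < n) (c : ℤ)
    (ha : ((halfFloorSum a n).negOnePow : ℤ) = jacobiSym a n) :
    ((halfFloorSum (a + 2 * c * n) n).negOnePow : ℤ) = jacobiSym (a + 2 * c * n) n := by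
  rw [halfFloorSum_add_mul _ _ hn, Int.negOnePow_add, mul_assoc, Int.negOnePow_two_mul, mul_one, ha]
  exact jacobiSym.mod_left' (by simp)

/-- **Eisenstein's lemma** for the Jacobi symbol. -/
theorem negOnePow_halfFloorSum_of_odd {n : ℕ} (hn : Odd n) {a : ℤ} (ha : Odd a)
    (h : Int.gcd a n = 1) : ((halfFloorSum a n).negOnePow : ℤ) = jacobiSym a n := by
  induction n using Nat.strong_induction_on generalizing a with
  | _ n ih =>
    have hpos : 0 < n := hn.pos
    rcases eq_or_ne n 1 with rfl | hn1
    · simp [halfFloorSum]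
    have small (b : ℕ) (hb : Odd b) (hbn : b < n) (hc : b.Coprime n) :
        ((halfFloorSum b n).negOnePow : ℤ) = jacobiSym b n := by
      have hr := halfFloorSum_add_halfFloorSum hc
      rw [jacobiSym.quadratic_reciprocity hb hn,
        ← ih b hbn hb (a := n) (by exact_mod_cast hn) (by simpa using hc.symm),
        eq_sub_of_add_eq' hr, Int.negOnePow_sub,
        Units.val_mul, Int.coe_negOnePow_natCast]
    have coprime_of (b : ℕ) (c : ℤ) (hc : a = b + c * n ∨ a = -b + c * n) : b.Coprime n := by
      rcases hc with rfl | rfl <;> simpa using h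
    have hm := Int.emod_add_mul_ediv a (2 * n)
    have h0 := Int.emod_nonneg a (show (2 * n : ℤ) ≠ 0 by omega)
    have hl := Int.emod_lt_of_pos a (show (0 : ℤ) < 2 * n by omega)
    generalize a / (2 * n) = c at hm
    obtain ⟨r, hr⟩ := Int.eq_ofNat_of_zero_le h0
    rw [hr] at hm h0 hl
    have hrodd : Odd r := by
      have : Odd ((r : ℤ) + 2 * (n * c)) := by rwa [← mul_assoc, hm]
      rw [Int.odd_add] at this
      exact_mod_cast this.mpr (even_two_mul _)
    rcases lt_or_ge r n with hrn | hrn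
    · have hc := coprime_of r (2 * c) (Or.inl (by linarith))
      rw [show a = r + 2 * c * n by linarith]
      exact negOnePow_halfFloorSum_add_two_mul hpos c (small r hrodd hrn hc)
    · obtain ⟨b, hb⟩ : ∃ b, r + b = 2 * n := ⟨2 * n - r, by omega⟩
      have hb' : (r : ℤ) + b = 2 * n := by exact_mod_cast hb
      have hc := coprime_of b (2 * (c + 1)) (Or.inr (by linarith))
      have hbn : b ≠ n := by
        rintro rfl
        exact hn1 (by simpa using hc)
      have hbodd : Odd b := by
        rw [Nat.odd_iff] at hrodd ⊢
        omega
      rw [show a = -b + 2 * (c + 1) * n by linarith]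
      exact negOnePow_halfFloorSum_add_two_mul hpos (c + 1)
        (negOnePow_halfFloorSum_neg hn (by simpa using hc) (small b hbodd (by omega) hc))

theorem negOnePow_halfFloorSum_of_even {n : ℕ} (hn : Odd n) {a : ℤ} (ha : Even a)
    (h : Int.gcd a n = 1) :
    ((halfFloorSum a n).negOnePow : ℤ) = jacobiSym 2 n * jacobiSym a n := by
  have hodd : Odd (a + 1 * n) := by
    rw [one_mul]
    exact ha.add_odd (by exact_mod_cast hn)
  have key := negOnePow_halfFloorSum_of_odd hn hodd (by simpa using h)
  rw [halfFloorSum_add_mul _ _ hn.pos, one_mul, Int.negOnePow_add, Units.val_mul,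
    ← jacobiSym_two_eq_negOnePow hn,
    jacobiSym.mod_left' (show (a + 1 * n) % (n : ℤ) = a % n by simp)] at key
  rw [← key, mul_left_comm, ← sq, jacobiSym.sq_one, mul_one]
  rw [Int.gcd_comm]
  exact_mod_cast Nat.coprime_two_right.mpr hn

/-- The dichotomy `⌊k x / n⌋ + ⌊k (1 - x) / n⌋ ∈ {-1, 0}` detects whether the residues of both
`k x` and `k (1 - x)` are less than `n / 2`. -/
theorem ite_emod_lt_half {n k : ℕ} {x : ℤ} (hx : Int.gcd x n = 1) (hx' : Int.gcd (1 - x) n = 1)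
    (hk : 0 < k) (hkn : 2 * k < n) :
    (if 2 * (((k : ℤ) * x) % (n : ℤ)) < (n : ℤ) ∧ 2 * (((k : ℤ) * (1 - x)) % (n : ℤ)) < (n : ℤ)
      then (1 : ℤ) else 0) = (k : ℤ) * x / n + (k : ℤ) * (1 - x) / n + 1 := by
  have hn : (0 : ℤ) < n := by omega
  have hp := emod_natCast_mul_pos hx hk (by omega)
  have hp' := emod_natCast_mul_pos hx' hk (by omega)
  have hl := Int.emod_lt_of_pos ((k : ℤ) * x) hn
  have hl' := Int.emod_lt_of_pos ((k : ℤ) * (1 - x)) hn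
  have hd := Int.mul_ediv_add_emod ((k : ℤ) * x) n
  have hd' := Int.mul_ediv_add_emod ((k : ℤ) * (1 - x)) n
  generalize (k : ℤ) * x / n = q at *
  generalize (k : ℤ) * (1 - x) / n = q' at *
  generalize (k : ℤ) * x % n = r at *
  generalize (k : ℤ) * (1 - x) % n = r' at *
  have hsum : n * (q + q') = k - r - r' := by linarith
  have hlt : q + q' < 1 := by
    by_contra! hc
    nlinarith
  have hgt : -2 < q + q' := by
    by_contra! hc
    nlinarith
  obtain hq | hq : q + q' = 0 ∨ q + q' = -1 := by omega
  · rw [hq] at hsum ⊢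
    rw [if_pos (by omega)]
    rfl
  · rw [hq] at hsum ⊢
    rw [if_neg (by omega)]
    rfl

theorem card_emod_lt_half_eq {n : ℕ} (hn : Odd n) {x : ℤ} (hx : Int.gcd x n = 1)
    (hx' : Int.gcd (1 - x) n = 1) :
    (((Ico 1 n).filter
        (fun k => 2 * k < n ∧ 2 * (((k : ℤ) * x) % (n : ℤ)) < (n : ℤ)
          ∧ 2 * (((k : ℤ) * (1 - x)) % (n : ℤ)) < (n : ℤ))).card : ℤ)
      = halfFloorSum x n + halfFloorSum (1 - x) n + (n / 2 : ℕ) := by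
  have hcard : ((n / 2 : ℕ) : ℤ) = ∑ k ∈ Ico 1 (n / 2 + 1), (1 : ℤ) := by simp
  have hfilter : (Ico 1 n).filter (fun k => 2 * k < n) = Ico 1 (n / 2 + 1) := by
    ext k
    rw [Nat.odd_iff] at hn
    simp only [mem_filter, mem_Ico]
    omega
  rw [← filter_filter, hfilter, hcard, halfFloorSum, halfFloorSum, ← sum_add_distrib,
    ← sum_add_distrib, card_filter, Nat.cast_sum]
  refine sum_congr rfl fun k hk => ?_
  rw [Nat.odd_iff] at hn
  rw [mem_Ico] at hk
  rw [← ite_emod_lt_half hx hx' (by omega) (by omega)]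
  push_cast
  rfl

/-- Theorem 1.1, (1.5): for a positive odd integer `n` and an integer `x` with
`gcd(x(1-x), n) = 1`, we have
`(-1)^{#{1 ≤ k < n/2 : {kx}_n < n/2 and {k(1-x)}_n < n/2}} = ((2x(x-1))/n)` (Jacobi symbol). -/
theorem statement2 (n : ℕ) (hn : Odd n) (hn0 : 0 < n) (x : ℤ)
    (hx : Int.gcd (x * (1 - x)) n = 1) :
    (-1 : ℤ) ^ ((Finset.Ico 1 n).filter
        (fun k => 2 * k < n ∧ 2 * (((k : ℤ) * x) % (n : ℤ)) < (n : ℤ)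
          ∧ 2 * (((k : ℤ) * (1 - x)) % (n : ℤ)) < (n : ℤ))).card
      = jacobiSym (2 * x * (x - 1)) n := by
  obtain ⟨h1, h2⟩ : Int.gcd x n = 1 ∧ Int.gcd (1 - x) n = 1 := by
    simpa only [← Int.isCoprime_iff_gcd_eq_one, IsCoprime.mul_left_iff] using hx
  have hprod : ((halfFloorSum x n).negOnePow : ℤ) * (halfFloorSum (1 - x) n).negOnePow =
      jacobiSym 2 n * jacobiSym x n * jacobiSym (1 - x) n := by
    rcases Int.even_or_odd x with he | ho
    · rw [negOnePow_halfFloorSum_of_even hn he h1,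
        negOnePow_halfFloorSum_of_odd hn (odd_one.sub_even he) h2]
    · rw [negOnePow_halfFloorSum_of_odd hn ho h1,
        negOnePow_halfFloorSum_of_even hn (odd_one.sub_odd ho) h2]
      ring
  have hcard := congrArg (fun m : ℤ => (m.negOnePow : ℤ)) (card_emod_lt_half_eq hn h1 h2)
  simp only [Int.negOnePow_add, Units.val_mul, hprod] at hcard
  rw [jacobiSym.mul_left, jacobiSym.mul_left, show x - 1 = -(1 - x) by ring,
    jacobiSym_neg_eq_negOnePow hn]
  simp only [Int.coe_negOnePow_natCast] at hcard ⊢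
  rw [hcard]
  ring
end

section
/- Let p be an odd prime and let a, b, c be integers with p ∤ ab(a+b) and p | c. Then S_p(a,b,c) ≡ ((−a(a+b))/p) (mod p). -/
open Finset in
theorem ZMod.prod_Ico_one_natCast {p : ℕ} [Fact p.Prime] {M : Type*} [CommMonoid M]
    (g : ZMod p → M) {n : ℕ} (hn : n ≤ p) :
    ∏ i ∈ Ico 1 n, g i = ∏ x : ZMod p with x ≠ 0 ∧ x.val < n, g x := by
  have hval : ∀ i ∈ Ico 1 n, (i : ZMod p).val = i := fun i hi =>
    ZMod.val_cast_of_lt ((mem_Ico.1 hi).2.trans_le hn)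
  refine prod_bij' (fun i _ => (i : ZMod p)) (fun x _ => x.val) ?_ ?_ hval ?_ ?_
  · intro i hi
    have h := hval i hi
    have hi' := mem_Ico.1 hi
    refine mem_filter.2 ⟨mem_univ _, fun h0 => ?_, by omega⟩
    rw [h0, ZMod.val_zero] at h
    omega
  · intro x hx
    obtain ⟨-, hx0, hxn⟩ := mem_filter.1 hx
    have := (ZMod.val_ne_zero x).2 hx0
    exact mem_Ico.2 ⟨by omega, hxn⟩
  · intro x _
    exact ZMod.natCast_zmod_val x
  · intro i _
    rfl

open Finset in
theorem FiniteField.prod_ne_zero_eq_neg_one (K : Type*) [Field K] [Fintype K] [DecidableEq K] :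
    ∏ x : K with x ≠ 0, x = -1 := by
  have h := congrArg Units.val (FiniteField.prod_univ_units_id_eq_neg_one (K := K))
  push_cast at h
  rw [← h]
  symm
  refine prod_bij (fun u _ => (u : K)) ?_ ?_ ?_ ?_
  · intro u _
    simp
  · intro u _ v _ h
    exact Units.ext h
  · intro x hx
    exact ⟨Units.mk0 x (mem_filter.1 hx).2, mem_univ _, rfl⟩
  · intro u _
    rfl

open Finset in
/-- A product of nonzero elements splits along a set that contains exactly one
element of each pair `x, -x`. -/
theorem prod_ne_zero_eq_prod_mul_neg {K M : Type*} [Field K] [Fintype K] [DecidableEq K]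
    [CommMonoid M] (P : K → Prop) [DecidablePred P] (hP : ∀ x, x ≠ 0 → (P (-x) ↔ ¬ P x))
    (g : K → M) :
    ∏ x : K with x ≠ 0, g x = ∏ x : K with x ≠ 0 ∧ P x, g x * g (-x) := by
  rw [← prod_filter_mul_prod_filter_not _ P, filter_filter, filter_filter, prod_mul_distrib]
  congr 1
  refine prod_bij' (fun x _ => -x) (fun x _ => -x) ?_ ?_ ?_ ?_ ?_ <;> simp +contextual [hP]

open Finset in
/-- If `P` holds for exactly one element of each pair `x, -x` of nonzero elements, then there
are `(p - 1) / 2` elements satisfying `P`. -/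
theorem ZMod.card_of_neg_iff_not {p : ℕ} [Fact p.Prime] (hodd : Odd p)
    (P : ZMod p → Prop) [DecidablePred P] (hP : ∀ x, x ≠ 0 → (P (-x) ↔ ¬ P x)) :
    #{x : ZMod p | x ≠ 0 ∧ P x} = p / 2 := by
  have h := prod_ne_zero_eq_prod_mul_neg P hP (fun _ => Multiplicative.ofAdd (1 : ℕ))
  simp only [prod_const] at h
  have h1 := congrArg Multiplicative.toAdd h
  simp only [toAdd_pow, toAdd_mul, toAdd_ofAdd, smul_eq_mul] at h1
  have h2 : #{x : ZMod p | x ≠ 0} = p - 1 := by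
    rw [filter_ne', card_erase_of_mem (mem_univ _), card_univ, ZMod.card]
  obtain ⟨k, hk⟩ := hodd
  omega

open Finset in
theorem ZMod.prod_sq_of_neg_iff_not {p : ℕ} [Fact p.Prime] (hodd : Odd p)
    (P : ZMod p → Prop) [DecidablePred P] (hP : ∀ x, x ≠ 0 → (P (-x) ↔ ¬ P x)) :
    ∏ x : ZMod p with x ≠ 0 ∧ P x, x ^ 2 = (-1) ^ (p / 2 + 1) := by
  have h := prod_ne_zero_eq_prod_mul_neg P hP (fun x => x)
  rw [FiniteField.prod_ne_zero_eq_neg_one] at h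
  have h1 : ∏ x : ZMod p with x ≠ 0 ∧ P x, x ^ 2
      = ∏ x : ZMod p with x ≠ 0 ∧ P x, (-1) * (x * -x) :=
    prod_congr rfl fun x _ => by ring
  rw [h1, prod_mul_distrib, ← h, prod_const, ZMod.card_of_neg_iff_not hodd P hP, pow_succ]

theorem ZMod.val_mul_neg_lt_iff {p : ℕ} [Fact p.Prime] {r x : ZMod p} (hr0 : r ≠ 0)
    (hr1 : r ≠ 1) (hx : x ≠ 0) :
    (r * -x).val < (-x).val ↔ ¬ (r * x).val < x.val := by
  have hrx : r * x ≠ 0 := mul_ne_zero hr0 hx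
  have hne : (r * x).val ≠ x.val := fun h =>
    hr1 (mul_right_cancel₀ hx (by rw [one_mul]; exact ZMod.val_injective p h))
  rw [mul_neg, ZMod.neg_val, ZMod.neg_val, if_neg hrx, if_neg hx]
  have := ZMod.val_lt x
  have := ZMod.val_lt (r * x)
  omega

open Finset in
/-- Grouping the pairs `i < j` by their ratio `i / j`. -/
theorem ZMod.prod_val_lt_eq_prod_ratio {p : ℕ} [Fact p.Prime] {M : Type*} [CommMonoid M]
    (F : ZMod p → ZMod p → M) :
    ∏ y : ZMod p with y ≠ 0, ∏ x : ZMod p with x ≠ 0 ∧ x.val < y.val, F x y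
      = ∏ r : ZMod p with r ≠ 0 ∧ r ≠ 1,
          ∏ y : ZMod p with y ≠ 0 ∧ (r * y).val < y.val, F (r * y) y := by
  have h : ∀ y ∈ ({y | y ≠ 0} : Finset (ZMod p)),
      ∏ x : ZMod p with x ≠ 0 ∧ x.val < y.val, F x y
        = ∏ r : ZMod p with r ≠ 0 ∧ (r * y).val < y.val, F (r * y) y := by
    intro y hy
    have hy0 : y ≠ 0 := (mem_filter.1 hy).2
    refine prod_bij' (fun x _ => x / y) (fun r _ => r * y) ?_ ?_ ?_ ?_ ?_ <;>
      simp +contextual [hy0]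
  rw [prod_congr rfl h]
  refine prod_comm' fun y r => ?_
  simp only [mem_filter, mem_univ, true_and]
  constructor
  · rintro ⟨hy, hr, hlt⟩
    refine ⟨⟨hy, hlt⟩, hr, ?_⟩
    rintro rfl
    simp at hlt
  · tauto

open Finset in
theorem FiniteField.prod_mul_linear {K : Type*} [Field K] [Fintype K] [DecidableEq K] {a b : K}
    (ha : a ≠ 0) (hb : b ≠ 0) (hab : a + b ≠ 0) :
    (∏ r : K with (r ≠ 0 ∧ r ≠ 1) ∧ a * r + b ≠ 0, r * (a * r + b)) * (b * (a + b)) ^ 2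
      = -(a * (a + b)) := by
  have hroot : ∀ r, a * r + b = 0 ↔ r = -b / a := fun r => by
    rw [eq_div_iff ha, eq_neg_iff_add_eq_zero, mul_comm]
  have ht1 : -b / a ≠ 1 := fun h => by
    apply hab
    have := (hroot 1).2 h.symm
    simpa using this
  set A : Finset K := {r : K | (r ≠ 0 ∧ r ≠ 1) ∧ a * r + b ≠ 0} with hA
  have e1 : (∏ r ∈ A, r) * (-b / a) = -1 := by
    rw [← FiniteField.prod_ne_zero_eq_neg_one K]
    have : ({x : K | x ≠ 0} : Finset K) = insert 1 (insert (-b / a) A) := by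
      ext x
      simp only [hA, mem_filter, mem_univ, true_and, mem_insert, ne_eq, hroot]
      by_cases h1 : x = 1
      · simp [h1]
      · by_cases h2 : x = -b / a
        · simp [h2, hb, ha]
        · simp [h1, h2]
    rw [this, prod_insert, prod_insert, one_mul, mul_comm]
    · simp [hA, hroot]
    · simp [hA, ht1.symm]
  have e2 : (∏ r ∈ A, (a * r + b)) * (b * (a + b)) = -1 := by
    rw [← FiniteField.prod_ne_zero_eq_neg_one K]
    have hbij : ∏ x : K with x ≠ 0, x = ∏ r : K with a * r + b ≠ 0, (a * r + b) := by
      symm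
      refine prod_bij' (fun r _ => a * r + b) (fun x _ => (x - b) / a) ?_ ?_ ?_ ?_ ?_ <;>
        simp +contextual [ha, mul_div_cancel₀]
    have : ({r : K | a * r + b ≠ 0} : Finset K) = insert 0 (insert 1 A) := by
      ext x
      simp only [hA, mem_filter, mem_univ, true_and, mem_insert, ne_eq]
      by_cases h1 : x = 1
      · simp [h1, hab]
      · by_cases h2 : x = 0
        · simp [h2, hb]
        · simp [h1, h2]
    rw [hbij, this, prod_insert, prod_insert]
    · ring
    · simp [hA]
    · simp [hA]
  rw [prod_mul_distrib]
  have e3 : (∏ r ∈ A, r) * b = a := by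
    field_simp at e1
    linear_combination -e1
  linear_combination (∏ r ∈ A, (a * r + b)) * b * (a + b) ^ 2 * e3 + a * (a + b) * e2

open Finset in
theorem ZMod.even_card_ratio {p : ℕ} [Fact p.Prime] (hodd : Odd p) {a b : ZMod p}
    (ha : a ≠ 0) (hb : b ≠ 0) (hab : a + b ≠ 0) :
    Even #{r : ZMod p | (r ≠ 0 ∧ r ≠ 1) ∧ a * r + b ≠ 0} := by
  have hroot : ∀ r, a * r + b = 0 ↔ r = -b / a := fun r => by
    rw [eq_div_iff ha, eq_neg_iff_add_eq_zero, mul_comm]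
  have ht1 : -b / a ≠ 1 := fun h => hab (by simpa using (hroot 1).2 h.symm)
  have hset : ({r : ZMod p | (r ≠ 0 ∧ r ≠ 1) ∧ a * r + b ≠ 0} : Finset (ZMod p))
      = ((univ.erase 0).erase 1).erase (-b / a) := by
    ext x
    simp only [mem_filter, mem_univ, true_and, mem_erase, ne_eq, hroot]
    tauto
  rw [hset, card_erase_of_mem (by simp [ht1, ha, hb]), card_erase_of_mem (by simp),
    card_erase_of_mem (mem_univ _), card_univ, ZMod.card]
  obtain ⟨k, rfl⟩ := hodd
  rcases k with _ | k
  · simp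
  · exact ⟨k, by omega⟩

open Finset in
theorem ZMod.prod_val_lt_quadratic {p : ℕ} [Fact p.Prime] (hodd : Odd p) {a b : ZMod p}
    (ha : a ≠ 0) (hb : b ≠ 0) (hab : a + b ≠ 0) :
    ∏ y : ZMod p with y ≠ 0, ∏ x : ZMod p with x ≠ 0 ∧ x.val < y.val,
      (if a * x ^ 2 + b * x * y = 0 then 1 else a * x ^ 2 + b * x * y)
      = (-(a * (a + b))) ^ (p / 2) := by
  have hfiber : ∀ r ∈ ({r | r ≠ 0 ∧ r ≠ 1} : Finset (ZMod p)),
      ∏ y : ZMod p with y ≠ 0 ∧ (r * y).val < y.val,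
        (if a * (r * y) ^ 2 + b * (r * y) * y = 0 then 1
          else a * (r * y) ^ 2 + b * (r * y) * y)
        = if a * r + b ≠ 0 then (r * (a * r + b)) ^ (p / 2) * (-1) ^ (p / 2 + 1) else 1 := by
    intro r hr
    obtain ⟨-, hr0, hr1⟩ := mem_filter.1 hr
    have hP : ∀ x : ZMod p, x ≠ 0 → ((r * -x).val < (-x).val ↔ ¬ (r * x).val < x.val) :=
      fun x hx => ZMod.val_mul_neg_lt_iff hr0 hr1 hx
    have hfac : ∀ y, a * (r * y) ^ 2 + b * (r * y) * y = r * (a * r + b) * y ^ 2 :=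
      fun y => by ring
    simp only [hfac]
    split_ifs with h
    · rw [← ZMod.prod_sq_of_neg_iff_not hodd (fun y => (r * y).val < y.val) hP,
        ← ZMod.card_of_neg_iff_not hodd (fun y => (r * y).val < y.val) hP, ← prod_const,
        ← prod_mul_distrib]
      refine prod_congr rfl fun y hy => if_neg ?_
      exact mul_ne_zero (mul_ne_zero hr0 h) (pow_ne_zero 2 (mem_filter.1 hy).2.1)
    · rw [not_not] at h
      simp [h]
  rw [ZMod.prod_val_lt_eq_prod_ratio
    (fun x y => if a * x ^ 2 + b * x * y = 0 then 1 else a * x ^ 2 + b * x * y),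
    prod_congr rfl hfiber, ← prod_filter, filter_filter, prod_mul_distrib, prod_const,
    ← pow_mul, ((ZMod.even_card_ratio hodd ha hb hab).mul_left _).neg_one_pow, mul_one,
    prod_pow, ← FiniteField.prod_mul_linear ha hb hab, mul_pow, ← pow_mul]
  have h2 : 2 * (p / 2) = p - 1 := by
    obtain ⟨k, rfl⟩ := hodd
    omega
  rw [h2, ZMod.pow_card_sub_one_eq_one (mul_ne_zero hb hab), mul_one]

/-- Theorem 1.2, part of (1.9): for an odd prime `p` and integers `a, b, c` with
`p ∤ ab(a+b)` and `p ∣ c`, we have `S_p(a,b,c) ≡ ((-a(a+b))/p) (mod p)`, where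
`S_p(a,b,c) = ∏_{1 ≤ i < j ≤ p-1, p ∤ ai²+bij+cj²} (ai² + bij + cj²)`. -/
theorem statement6 (p : ℕ) [Fact p.Prime] (hodd : Odd p) (a b c : ℤ)
    (h1 : ¬ (p : ℤ) ∣ a * b * (a + b)) (h2 : (p : ℤ) ∣ c) :
    (∏ j ∈ Finset.Ico 1 p, ∏ i ∈ Finset.Ico 1 j,
        if (p : ℤ) ∣ (a * (i : ℤ) ^ 2 + b * (i : ℤ) * (j : ℤ) + c * (j : ℤ) ^ 2) then 1
        else a * (i : ℤ) ^ 2 + b * (i : ℤ) * (j : ℤ) + c * (j : ℤ) ^ 2)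
      ≡ legendreSym p (-(a * (a + b))) [ZMOD (p : ℤ)] := by
  have hcast : ∀ z : ℤ, (p : ℤ) ∣ z ↔ (z : ZMod p) = 0 := fun z =>
    (ZMod.intCast_zmod_eq_zero_iff_dvd z p).symm
  have hc : (c : ZMod p) = 0 := (hcast c).1 h2
  rw [hcast] at h1
  push_cast at h1
  have hab : (a + b : ZMod p) ≠ 0 := right_ne_zero_of_mul h1
  have ha : (a : ZMod p) ≠ 0 := left_ne_zero_of_mul (left_ne_zero_of_mul h1)
  have hb : (b : ZMod p) ≠ 0 := right_ne_zero_of_mul (left_ne_zero_of_mul h1)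
  rw [← ZMod.intCast_eq_intCast_iff, legendreSym.eq_pow]
  simp only [hcast]
  push_cast [apply_ite (Int.cast : ℤ → ZMod p)]
  simp only [hc, zero_mul, add_zero]
  rw [← ZMod.prod_val_lt_quadratic hodd ha hb hab]
  have hinner : ∀ j ∈ Finset.Ico 1 p, ∏ i ∈ Finset.Ico 1 j,
      (if (a * (i : ZMod p) ^ 2 + b * i * j : ZMod p) = 0 then 1
        else (a * (i : ZMod p) ^ 2 + b * i * j : ZMod p))
      = ∏ x : ZMod p with x ≠ 0 ∧ x.val < (j : ZMod p).val,
        (if (a * x ^ 2 + b * x * j : ZMod p) = 0 then 1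
          else (a * x ^ 2 + b * x * j : ZMod p)) := by
    intro j hj
    have hjp := (Finset.mem_Ico.1 hj).2
    rw [ZMod.val_cast_of_lt hjp]
    exact ZMod.prod_Ico_one_natCast
      (fun x : ZMod p => if (a * x ^ 2 + b * x * j : ZMod p) = 0 then 1
        else (a * x ^ 2 + b * x * j : ZMod p)) hjp.le
  rw [Finset.prod_congr rfl hinner, ZMod.prod_Ico_one_natCast
    (fun y : ZMod p => ∏ x : ZMod p with x ≠ 0 ∧ x.val < y.val,
      (if (a * x ^ 2 + b * x * y : ZMod p) = 0 then 1
        else (a * x ^ 2 + b * x * y : ZMod p))) le_rfl]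
  simp only [ZMod.val_lt, and_true]
end

section
/- Let p be an odd prime and let a, b be integers with ab ≡ −1 (mod p). If p ≡ 1 (mod 4) and p ∤ (a−b), then −{a,b}_p ≡ ((a−b)/p) (mod p); if p ≡ 3 (mod 4), then −{a,b}_p ≡ ((a(a−b))/p) (mod p). -/
section HalfSystem

variable {K : Type*} [Field K] [Fintype K] [DecidableEq K]

/-- A half-system of a finite field: every nonzero `x` satisfies exactly one of
`x ∈ H` and `-x ∈ H`. -/
def IsHalfSystem (H : Finset K) : Prop :=
  0 ∉ H ∧ ∀ x : K, x ≠ 0 → (-x ∈ H ↔ x ∉ H)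

/-- Replaces zero factors of a product by one. -/
def oneIfZero (x : K) : K := if x = 0 then 1 else x

theorem prod_oneIfZero : ∏ x : K, oneIfZero x = -1 := by
  have h := FiniteField.prod_univ_units_id_eq_neg_one (K := K)
  have h2 := congrArg (Units.coeHom K) h
  rw [map_prod] at h2
  simp only [Units.coeHom_apply, Units.val_neg, Units.val_one] at h2
  rw [← h2, ← Finset.mul_prod_erase Finset.univ _ (Finset.mem_univ (0 : K))]
  simp only [oneIfZero, if_true, one_mul]
  symm
  refine Finset.prod_bij (fun u _ => (u : K)) (by simp) (fun _ _ _ _ h => Units.ext h)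
    (fun x hx => ⟨Units.mk0 x (by simpa using hx), Finset.mem_univ _, rfl⟩) (by simp)

theorem IsHalfSystem.prod_univ {H : Finset K} (hH : IsHalfSystem H) (f : K → K) :
    ∏ x : K, f x = f 0 * ∏ j ∈ H, f j * f (-j) := by
  obtain ⟨h0, hneg⟩ := hH
  have hcompl : (Finset.univ.erase (0 : K)).filter (fun x => ¬ x ∈ H)
      = H.image (fun x => -x) := by
    ext x
    simp only [Finset.mem_filter, Finset.mem_erase, Finset.mem_univ, Finset.mem_image]
    constructor
    · rintro ⟨⟨hx, -⟩, hxH⟩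
      exact ⟨-x, (hneg x hx).2 hxH, neg_neg x⟩
    · rintro ⟨y, hy, rfl⟩
      have hy0 : y ≠ 0 := fun h => h0 (h ▸ hy)
      exact ⟨⟨neg_ne_zero.2 hy0, trivial⟩, fun h => (hneg y hy0).1 h hy⟩
  have hmem : (Finset.univ.erase (0 : K)).filter (fun x => x ∈ H) = H := by
    ext x
    simp only [Finset.mem_filter, Finset.mem_erase, Finset.mem_univ]
    exact ⟨fun h => h.2, fun h => ⟨⟨fun h' => h0 (h' ▸ h), trivial⟩, h⟩⟩
  rw [← Finset.mul_prod_erase Finset.univ f (Finset.mem_univ 0),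
    ← Finset.prod_filter_mul_prod_filter_not _ (fun x => x ∈ H), hcompl, hmem,
    Finset.prod_image (fun _ _ _ _ h => neg_injective h), Finset.prod_mul_distrib]

theorem IsHalfSystem.prod_sq {H : Finset K} (hH : IsHalfSystem H) :
    (∏ j ∈ H, j) ^ 2 * (-1) ^ H.card = -1 := by
  have h := hH.prod_univ oneIfZero
  rw [prod_oneIfZero, oneIfZero, if_pos rfl, one_mul] at h
  refine Eq.trans ?_ h.symm
  rw [sq, ← Finset.prod_const, ← Finset.prod_mul_distrib, ← Finset.prod_mul_distrib]
  refine Finset.prod_congr rfl fun j hj => ?_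
  have hj0 : j ≠ 0 := fun h => hH.1 (h ▸ hj)
  simp [oneIfZero, hj0]

theorem IsHalfSystem.prod_sub_mul_prod_add {H : Finset K} (hH : IsHalfSystem H) {a i : K}
    (ha : a ≠ 0) (hi : i ≠ 0) :
    (∏ j ∈ H, oneIfZero (i - a * j) * oneIfZero (i + a * j)) * i = -1 := by
  have h1 : ∏ x : K, oneIfZero (i - a * x) = -1 := by
    rw [← prod_oneIfZero (K := K)]
    exact Fintype.prod_equiv ((Equiv.mulLeft₀ a ha).trans (Equiv.subLeft i)) _ _ (by simp)
  rw [hH.prod_univ] at h1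
  rw [← h1, mul_comm]
  simp [oneIfZero, hi]

/-- The product over a half-system is, up to sign, the inverse of
`(a - b) ^ |H| * a ^ |H| ^ 2`. -/
theorem IsHalfSystem.neg_prod_mul {H : Finset K} (hH : IsHalfSystem H) {a b : K}
    (hab : a * b = -1) (hne : a ≠ b) :
    -(∏ i ∈ H, ∏ j ∈ H,
        if i - a * j = 0 ∨ i - b * j = 0 then 1 else (i - a * j) * (i - b * j))
      * ((a - b) ^ H.card * (a ^ H.card) ^ H.card) = 1 := by
  have hj0 : ∀ j ∈ H, j ≠ 0 := fun j hj h => hH.1 (h ▸ hj)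
  have ha : a ≠ 0 := by rintro rfl; simp at hab
  have hsub : a - b ≠ 0 := sub_ne_zero.2 hne
  have hroot : ∀ i j : K, i - b * j = 0 ↔ j = -(a * i) := fun i j =>
    ⟨fun h => by linear_combination a * h + j * hab,
      fun h => by rw [h]; linear_combination i * hab⟩
  set D := ∏ j ∈ H, if a * j ∈ H then 1 else a with hD
  have hQE : (∏ i ∈ H, ∏ j ∈ H,
        if i - a * j = 0 ∨ i - b * j = 0 then 1 else (i - a * j) * (i - b * j))
      * ((∏ i ∈ H, ∏ j ∈ H, if i = a * j then (a - b) * j else 1)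
        * (∏ i ∈ H, ∏ j ∈ H, if j = -(a * i) then (b - a) * j else 1))
      = (∏ i ∈ H, ∏ j ∈ H, oneIfZero (i - a * j))
        * ∏ i ∈ H, ∏ j ∈ H, oneIfZero (i - b * j) := by
    simp only [← Finset.prod_mul_distrib]
    refine Finset.prod_congr rfl fun i _ => Finset.prod_congr rfl fun j hj => ?_
    simp only [← hroot, ← sub_eq_zero (a := i) (b := a * j), oneIfZero]
    have hj' := mul_ne_zero hsub (hj0 j hj)
    by_cases h1 : i - a * j = 0 <;> by_cases h2 : i - b * j = 0
    · exact absurd (by linear_combination h2 - h1) hj'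
    · simp only [h1, h2, if_true, if_false, true_or]
      linear_combination -h1
    · simp only [h1, h2, if_true, if_false, or_true]
      linear_combination -h2
    · simp [h1, h2]
  have hE : (∏ i ∈ H, ∏ j ∈ H, if i = a * j then (a - b) * j else 1)
      * (∏ i ∈ H, ∏ j ∈ H, if j = -(a * i) then (b - a) * j else 1)
      = (a - b) ^ H.card * (∏ j ∈ H, j) * D := by
    rw [Finset.prod_comm, hD, ← Finset.prod_const, ← Finset.prod_mul_distrib,
      ← Finset.prod_mul_distrib, ← Finset.prod_mul_distrib]
    refine Finset.prod_congr rfl fun j hj => ?_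
    simp only [Finset.prod_ite_eq', hH.2 _ (mul_ne_zero ha (hj0 j hj))]
    split_ifs <;> first | contradiction | ring
  have hCD : (∏ i ∈ H, ∏ j ∈ H, if j = -(a * i) then 1 else a) * D
      = (a ^ H.card) ^ H.card := by
    rw [hD, ← Finset.prod_mul_distrib, ← Finset.prod_const (s := H) (a ^ H.card)]
    refine Finset.prod_congr rfl fun i hi => ?_
    have hD' : (if a * i ∈ H then 1 else a) = ∏ j ∈ H, if j = -(a * i) then a else 1 := by
      simp only [Finset.prod_ite_eq', hH.2 _ (mul_ne_zero ha (hj0 i hi)), ite_not]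
    rw [hD', ← Finset.prod_mul_distrib, ← Finset.prod_const]
    refine Finset.prod_congr rfl fun j _ => ?_
    split_ifs <;> simp
  have hPC : (∏ i ∈ H, ∏ j ∈ H, oneIfZero (i - b * j))
      * (∏ i ∈ H, ∏ j ∈ H, if j = -(a * i) then 1 else a)
      = ∏ i ∈ H, ∏ j ∈ H, oneIfZero (i + a * j) := by
    rw [Finset.prod_comm (f := fun i j => oneIfZero (i + a * j))]
    simp only [← Finset.prod_mul_distrib]
    refine Finset.prod_congr rfl fun i _ => Finset.prod_congr rfl fun j _ => ?_
    simp only [← hroot, oneIfZero]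
    have h : j + a * i = (i - b * j) * a := by linear_combination j * hab
    rw [h]
    by_cases h2 : i - b * j = 0 <;> simp [h2, ha]
  have hPF : (∏ i ∈ H, ∏ j ∈ H, oneIfZero (i - a * j))
      * (∏ i ∈ H, ∏ j ∈ H, oneIfZero (i + a * j)) * ∏ i ∈ H, i = (-1) ^ H.card := by
    simp only [← Finset.prod_mul_distrib, ← Finset.prod_const]
    exact Finset.prod_congr rfl fun i hi => hH.prod_sub_mul_prod_add ha (hj0 i hi)
  have hsq := hH.prod_sq
  have hsign : ((-1 : K) ^ H.card) * (-1) ^ H.card = 1 := by rw [← mul_pow]; simp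
  rw [hE] at hQE
  rw [← hCD]
  rw [← hPC] at hPF
  generalize (∏ i ∈ H, ∏ j ∈ H, if j = -(a * i) then 1 else a) = C at *
  generalize (∏ i ∈ H, ∏ j ∈ H,
    if i - a * j = 0 ∨ i - b * j = 0 then 1 else (i - a * j) * (i - b * j)) = Q at *
  generalize (∏ i ∈ H, ∏ j ∈ H, oneIfZero (i - a * j)) = P at *
  generalize (∏ i ∈ H, ∏ j ∈ H, oneIfZero (i - b * j)) = R at *
  generalize (∏ j ∈ H, j) = F at *
  generalize (-1 : K) ^ H.card = s at *
  linear_combination s * hPF + s * F * C * hQE + hsign - Q * (a - b) ^ H.card * C * D * hsq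

end HalfSystem

theorem injOn_natCast_Icc_half (p : ℕ) [Fact p.Prime] :
    Set.InjOn (fun i : ℕ => (i : ZMod p)) (Finset.Icc 1 ((p - 1) / 2)) := by
  intro i hi j hj h
  have hp := (Fact.out : p.Prime).pos
  simp only [Finset.coe_Icc, Set.mem_Icc] at hi hj
  have h' := (ZMod.natCast_eq_natCast_iff' i j p).1 h
  rwa [Nat.mod_eq_of_lt (by omega), Nat.mod_eq_of_lt (by omega)] at h'

theorem isHalfSystem_image_Icc_half (p : ℕ) [Fact p.Prime] (hodd : Odd p) :
    IsHalfSystem ((Finset.Icc 1 ((p - 1) / 2)).image fun i : ℕ => (i : ZMod p)) := by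
  have hp := (Fact.out : p.Prime).pos
  obtain ⟨m, hm⟩ := hodd
  have key : ∀ x : ZMod p, x ∈ (Finset.Icc 1 ((p - 1) / 2)).image (fun i : ℕ => (i : ZMod p))
      ↔ x.val ∈ Finset.Icc 1 ((p - 1) / 2) := by
    intro x
    rw [Finset.mem_image]
    constructor
    · rintro ⟨i, hi, rfl⟩
      rwa [ZMod.val_cast_of_lt]
      rw [Finset.mem_Icc] at hi
      omega
    · exact fun h => ⟨x.val, h, ZMod.natCast_zmod_val x⟩
  refine ⟨by simp [key], fun x hx => ?_⟩
  have : NeZero x := ⟨hx⟩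
  have hlt := x.val_lt
  have hpos : x.val ≠ 0 := (ZMod.val_ne_zero x).2 hx
  rw [key, key, ZMod.val_neg_of_ne_zero, Finset.mem_Icc, Finset.mem_Icc]
  omega

/-- Both residue classes of `p` modulo `4` at once: `-{a,b}_p` is congruent to the product of
Legendre symbols `((a - b)/p) (a/p) ^ ((p - 1) / 2)`. -/
theorem neg_prod_modEq_legendreSym (p : ℕ) [Fact p.Prime] (hodd : Odd p) (a b : ℤ)
    (hab : a * b ≡ -1 [ZMOD (p : ℤ)]) (hne : ¬ (p : ℤ) ∣ a - b) :
    -(∏ i ∈ Finset.Icc 1 ((p - 1) / 2), ∏ j ∈ Finset.Icc 1 ((p - 1) / 2),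
          if (p : ℤ) ∣ (i : ℤ) - a * (j : ℤ) ∨ (p : ℤ) ∣ (i : ℤ) - b * (j : ℤ) then 1
          else ((i : ℤ) - a * (j : ℤ)) * ((i : ℤ) - b * (j : ℤ)))
        ≡ legendreSym p (a - b) * legendreSym p a ^ ((p - 1) / 2) [ZMOD (p : ℤ)] := by
  have hn : p / 2 = (p - 1) / 2 := by obtain ⟨m, hm⟩ := hodd; omega
  have hab' : (a : ZMod p) * b = -1 := by
    have := (ZMod.intCast_eq_intCast_iff _ _ _).2 hab
    push_cast at this
    exact this
  have hsub : ((a - b : ℤ) : ZMod p) ≠ 0 := fun h =>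
    hne ((ZMod.intCast_zmod_eq_zero_iff_dvd _ _).1 h)
  have ha : (a : ZMod p) ≠ 0 := by intro h; simp [h] at hab'
  have hne' : (a : ZMod p) ≠ b := fun h => hsub (by push_cast; rw [h, sub_self])
  have main := (isHalfSystem_image_Icc_half p hodd).neg_prod_mul hab' hne'
  have hinj := injOn_natCast_Icc_half p
  have hsq : (legendreSym p (a - b) * legendreSym p a ^ ((p - 1) / 2)) *
      (legendreSym p (a - b) * legendreSym p a ^ ((p - 1) / 2)) = 1 := by
    have h1 := legendreSym.sq_one p hsub
    have h2 := legendreSym.sq_one p ha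
    rw [← sq, mul_pow, h1, ← pow_mul, mul_comm _ 2, pow_mul, h2]
    simp
  have hsq' := congrArg (fun z : ℤ => (z : ZMod p)) hsq
  rw [← ZMod.intCast_eq_intCast_iff]
  simp only [Finset.card_image_of_injOn hinj, Finset.prod_image hinj, Nat.card_Icc,
    Nat.add_sub_cancel] at main
  simp only [← ZMod.intCast_zmod_eq_zero_iff_dvd]
  push_cast [legendreSym.eq_pow, hn] at hsq' ⊢
  generalize ((a : ZMod p) - b) ^ ((p - 1) / 2) * ((a : ZMod p) ^ ((p - 1) / 2)) ^ ((p - 1) / 2)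
    = L at *
  have hL : L ≠ 0 := by rintro rfl; simp at hsq'
  refine mul_right_cancel₀ hL ?_
  rw [hsq']
  exact main

/-- Theorem 1.3(i), (1.12): let `p` be an odd prime and `a, b` integers with
`ab ≡ -1 (mod p)`, and let
`{a,b}_p = ∏_{1 ≤ i,j ≤ (p-1)/2, i ≢ aj, i ≢ bj (mod p)} (i - aj)(i - bj)`.
If `p ≡ 1 (mod 4)` and `p ∤ a - b`, then `-{a,b}_p ≡ ((a-b)/p) (mod p)`;
if `p ≡ 3 (mod 4)`, then `-{a,b}_p ≡ ((a(a-b))/p) (mod p)`. -/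
theorem statement8 (p : ℕ) [Fact p.Prime] (hodd : Odd p) (a b : ℤ)
    (hab : a * b ≡ -1 [ZMOD (p : ℤ)]) :
    (p % 4 = 1 → ¬ (p : ℤ) ∣ a - b →
      -(∏ i ∈ Finset.Icc 1 ((p - 1) / 2), ∏ j ∈ Finset.Icc 1 ((p - 1) / 2),
          if (p : ℤ) ∣ (i : ℤ) - a * (j : ℤ) ∨ (p : ℤ) ∣ (i : ℤ) - b * (j : ℤ) then 1
          else ((i : ℤ) - a * (j : ℤ)) * ((i : ℤ) - b * (j : ℤ)))
        ≡ legendreSym p (a - b) [ZMOD (p : ℤ)]) ∧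
    (p % 4 = 3 →
      -(∏ i ∈ Finset.Icc 1 ((p - 1) / 2), ∏ j ∈ Finset.Icc 1 ((p - 1) / 2),
          if (p : ℤ) ∣ (i : ℤ) - a * (j : ℤ) ∨ (p : ℤ) ∣ (i : ℤ) - b * (j : ℤ) then 1
          else ((i : ℤ) - a * (j : ℤ)) * ((i : ℤ) - b * (j : ℤ)))
        ≡ legendreSym p (a * (a - b)) [ZMOD (p : ℤ)]) := by
  have hsplit : (p - 1) / 2 = 2 * (p / 4) + if p % 4 = 3 then 1 else 0 := by
    obtain ⟨m, hm⟩ := hodd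
    split_ifs <;> omega
  have ha : (a : ZMod p) ≠ 0 := by
    have := (ZMod.intCast_eq_intCast_iff _ _ _).2 hab
    intro h
    simp [h] at this
  have hsq := legendreSym.sq_one p ha
  constructor
  · intro h4 hne
    have h := neg_prod_modEq_legendreSym p hodd a b hab hne
    have hpow : legendreSym p a ^ ((p - 1) / 2) = 1 := by
      rw [hsplit, if_neg (by omega), add_zero, pow_mul, hsq, one_pow]
    rwa [hpow, mul_one] at h
  · intro h4
    have hne : ¬ (p : ℤ) ∣ a - b := by
      intro hdvd
      refine ZMod.mod_four_ne_three_of_sq_eq_neg_one (p := p) (y := (a : ZMod p)) ?_ h4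
      have h1 := (ZMod.intCast_zmod_eq_zero_iff_dvd _ _).2 hdvd
      have h2 := (ZMod.intCast_eq_intCast_iff _ _ _).2 hab
      push_cast at h1 h2
      linear_combination (a : ZMod p) * h1 + h2
    have h := neg_prod_modEq_legendreSym p hodd a b hab hne
    have hpow : legendreSym p a ^ ((p - 1) / 2) = legendreSym p a := by
      rw [hsplit, if_pos h4, pow_succ, pow_mul, hsq, one_pow, one_mul]
    rwa [hpow, mul_comm, ← legendreSym.mul] at h
end

section
/- Let p be an odd prime and let A be an integer with p | A² + 4. Then p ≡ 1 (mod 4), there exists k ∈ {0,1} with A ≡ 2·(−1)^k·((p−1)/2)! (mod p), and: if p ≡ 1 (mod 8) then T_p(1, −A, −1) ≡ (−1)^{(p+7)/8}·((p−1)/2)! (mod p); if p ≡ 5 (mod 8) and A ≡ 2·(−1)^k·((p−1)/2)! (mod p) with k ∈ {0,1}, then T_p(1, −A, −1) ≡ (−1)^{k + (p−5)/8} (mod p). -/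
open Finset

theorem Nat.prod_Icc_one_id_eq_factorial (n : ℕ) : ∏ i ∈ Icc 1 n, i = n.factorial :=
  prod_Ico_id_eq_factorial n

section

variable {p : ℕ} [Fact p.Prime]

theorem ZMod.prod_Ico_natCast_eq_prod_erase_zero {M : Type*} [CommMonoid M] (f : ZMod p → M) :
    ∏ i ∈ Ico 1 p, f (i : ZMod p) = ∏ x ∈ univ.erase (0 : ZMod p), f x := by
  refine prod_nbij' (fun i => (i : ZMod p)) (fun x => x.val) ?_ ?_ ?_ ?_ ?_
  · intro i hi
    rw [mem_Ico] at hi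
    simp only [mem_erase, mem_univ, and_true, ne_eq, ZMod.natCast_eq_zero_iff]
    exact Nat.not_dvd_of_pos_of_lt hi.1 hi.2
  · intro x hx
    rw [mem_erase] at hx
    rw [mem_Ico]
    exact ⟨Nat.pos_of_ne_zero fun h => hx.1 ((ZMod.val_eq_zero x).1 h), x.val_lt⟩
  · intro i hi
    rw [mem_Ico] at hi
    exact ZMod.val_cast_of_lt hi.2
  · intro x _
    exact ZMod.natCast_zmod_val x
  · intros
    rfl

theorem ZMod.prod_Icc_half_mul_neg {M : Type*} [CommMonoid M] (hodd : Odd p)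
    (f : ZMod p → M) :
    ∏ i ∈ Icc 1 ((p - 1) / 2), f (i : ZMod p) * f (-(i : ZMod p)) =
      ∏ x ∈ univ.erase (0 : ZMod p), f x := by
  obtain ⟨n, hn⟩ := hodd
  have hn' : (p - 1) / 2 = n := by omega
  rw [← ZMod.prod_Ico_natCast_eq_prod_erase_zero, hn', prod_mul_distrib,
    ← prod_Ico_consecutive _ (show 1 ≤ n + 1 by omega) (show n + 1 ≤ p by omega)]
  congr 1
  refine prod_nbij' (fun i => p - i) (fun i => p - i) ?_ ?_ ?_ ?_ ?_
  · intro i hi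
    rw [mem_Icc] at hi
    rw [mem_Ico]
    omega
  · intro i hi
    rw [mem_Ico] at hi
    rw [mem_Icc]
    omega
  · intro i hi
    rw [mem_Icc] at hi
    omega
  · intro i hi
    rw [mem_Ico] at hi
    omega
  · intro i hi
    rw [mem_Icc] at hi
    rw [Nat.cast_sub (by omega)]
    simp

theorem ZMod.sum_Icc_half_add_neg {M : Type*} [AddCommMonoid M] (hodd : Odd p)
    (f : ZMod p → M) :
    ∑ i ∈ Icc 1 ((p - 1) / 2), (f (i : ZMod p) + f (-(i : ZMod p))) =
      ∑ x ∈ univ.erase (0 : ZMod p), f x :=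
  ZMod.prod_Icc_half_mul_neg (M := Multiplicative M) hodd f

theorem ZMod.prod_erase_zero_id : ∏ x ∈ univ.erase (0 : ZMod p), x = -1 := by
  rw [← ZMod.prod_Ico_natCast_eq_prod_erase_zero (fun x : ZMod p => x), ZMod.prod_Ico_one_prime]

theorem ZMod.half_factorial_sq (h : p % 4 = 1) :
    (((p - 1) / 2).factorial : ZMod p) ^ 2 = -1 := by
  have hodd : Odd p := Nat.odd_iff.2 (by omega)
  have heven : Even ((p - 1) / 2) := Nat.even_iff.2 (by omega)
  rw [← ZMod.prod_erase_zero_id, ← ZMod.prod_Icc_half_mul_neg hodd, prod_mul_distrib, prod_neg,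
    Nat.card_Icc, Nat.add_sub_cancel, heven.neg_one_pow, one_mul, ← Nat.cast_prod,
    Nat.prod_Icc_one_id_eq_factorial, sq]

/-- `x` if `x ≠ 0`, and `1` otherwise. -/
def zeroToOne {F : Type*} [Zero F] [One F] [DecidableEq F] (x : F) : F := if x = 0 then 1 else x

theorem zeroToOne_sq {F : Type*} [Field F] [DecidableEq F] (x : F) :
    zeroToOne (x ^ 2) = zeroToOne x ^ 2 := by
  unfold zeroToOne
  by_cases hx : x = 0 <;> simp [hx]

theorem zeroToOne_mul {F : Type*} [Field F] [DecidableEq F] {c : F} (hc : c ≠ 0) (x : F) :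
    zeroToOne (c * x) = c ^ (if x = 0 then 0 else 1) * zeroToOne x := by
  unfold zeroToOne
  by_cases hx : x = 0 <;> simp [hx, hc]

theorem ZMod.prod_erase_zero_zeroToOne_sub {a : ZMod p} (ha : a ≠ 0) :
    (∏ x ∈ univ.erase (0 : ZMod p), zeroToOne (x - a)) * a = 1 := by
  have h₁ : (∏ x ∈ univ.erase (0 : ZMod p), zeroToOne (x - a)) * -a = -1 := by
    calc
      _ = ∏ x : ZMod p, zeroToOne (x - a) := by
        rw [← prod_erase_mul univ _ (mem_univ (0 : ZMod p))]
        simp [zeroToOne, ha]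
      _ = ∏ x : ZMod p, zeroToOne x := Equiv.prod_comp (Equiv.subRight a) zeroToOne
      _ = ∏ x ∈ univ.erase (0 : ZMod p), x := by
        rw [← prod_erase_mul univ _ (mem_univ (0 : ZMod p))]
        rw [show zeroToOne (0 : ZMod p) = 1 by simp [zeroToOne], mul_one]
        refine prod_congr rfl fun x hx => ?_
        simp [zeroToOne, (mem_erase.1 hx).1]
      _ = -1 := ZMod.prod_erase_zero_id
  linear_combination -h₁

theorem ZMod.natCast_ne_zero_of_mem_Icc_half {j : ℕ} (hj : j ∈ Icc 1 ((p - 1) / 2)) :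
    (j : ZMod p) ≠ 0 := by
  rw [mem_Icc] at hj
  rw [ne_eq, ZMod.natCast_eq_zero_iff]
  exact Nat.not_dvd_of_pos_of_lt (by omega) (by omega)

/-- Multiplication by a square root of `-1` sends exactly half of `{1, …, (p-1)/2}` to
`{-1, …, -(p-1)/2}`. -/
theorem ZMod.two_mul_sum_neg_sub_eq_zero (hodd : Odd p) {c : ZMod p} (hc : c ^ 2 = -1) :
    2 * ∑ j ∈ Icc 1 ((p - 1) / 2), ∑ i ∈ Icc 1 ((p - 1) / 2),
      (if -(i : ZMod p) - c * j = 0 then 1 else 0) = (p - 1) / 2 := by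
  have hc0 : c ≠ 0 := by
    rintro rfl
    simp at hc
  have hswap : ∑ j ∈ Icc 1 ((p - 1) / 2), ∑ i ∈ Icc 1 ((p - 1) / 2),
      (if -(i : ZMod p) - c * j = 0 then 1 else 0) =
      ∑ j ∈ Icc 1 ((p - 1) / 2), ∑ i ∈ Icc 1 ((p - 1) / 2),
      (if (i : ZMod p) - c * j = 0 then 1 else 0) := by
    rw [sum_comm]
    refine sum_congr rfl fun j _ => sum_congr rfl fun i _ => ?_
    have : -(j : ZMod p) - c * i = 0 ↔ (i : ZMod p) - c * j = 0 := by
      rw [show -(j : ZMod p) - c * i = -c * (i - c * j) by linear_combination (-(j : ZMod p)) * hc]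
      simp [hc0]
    simp only [this]
  rw [two_mul]
  nth_rewrite 1 [hswap]
  simp only [← sum_add_distrib]
  calc
    _ = ∑ j ∈ Icc 1 ((p - 1) / 2), 1 := by
      refine sum_congr rfl fun j hj => ?_
      rw [ZMod.sum_Icc_half_add_neg hodd (fun x => if x - c * (j : ZMod p) = 0 then 1 else 0)]
      simp [sub_eq_zero, hc0, ZMod.natCast_ne_zero_of_mem_Icc_half hj]
    _ = _ := by simp

theorem ZMod.prod_zeroToOne_sub_sq (h : p % 4 = 1) {c : ZMod p} (hc : c ^ 2 = -1) :
    ∏ i ∈ Icc 1 ((p - 1) / 2), ∏ j ∈ Icc 1 ((p - 1) / 2),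
      zeroToOne ((i : ZMod p) - c * j) ^ 2 =
    -c ^ ((p - 1) / 4) * ((p - 1) / 2).factorial := by
  have hodd : Odd p := Nat.odd_iff.2 (by omega)
  have hc0 : c ≠ 0 := by
    rintro rfl
    simp at hc
  have hM := ZMod.two_mul_sum_neg_sub_eq_zero hodd hc
  have hfac := ZMod.half_factorial_sq h
  obtain ⟨m, hm⟩ : ∃ m, p = 4 * m + 1 := ⟨p / 4, by omega⟩
  have hm4 : (p - 1) / 4 = m := by omega
  have hm2 : (p - 1) / 2 = 2 * m := by omega
  rw [hm4]
  set n := (p - 1) / 2 with hn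
  set M := ∑ j ∈ Icc 1 n, ∑ i ∈ Icc 1 n, (if -(i : ZMod p) - c * j = 0 then 1 else 0) with hMdef
  set N := ∑ j ∈ Icc 1 n, ∑ i ∈ Icc 1 n, (if -(i : ZMod p) - c * j = 0 then 0 else 1) with hNdef
  have hMN : M + N = n * n := by
    rw [hMdef, hNdef]
    simp only [← sum_add_distrib]
    calc
      _ = ∑ j ∈ Icc 1 n, ∑ i ∈ Icc 1 n, 1 := by
        refine sum_congr rfl fun j _ => sum_congr rfl fun i _ => ?_
        split_ifs <;> rfl
      _ = _ := by simp
  set T := ∏ i ∈ Icc 1 n, ∏ j ∈ Icc 1 n, zeroToOne ((i : ZMod p) - c * j) ^ 2 with hT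
  have hfactor : T = c ^ N * ∏ j ∈ Icc 1 n, ∏ x ∈ univ.erase (0 : ZMod p),
      zeroToOne (x - c * j) := by
    calc
      T = (∏ j ∈ Icc 1 n, ∏ i ∈ Icc 1 n, zeroToOne ((j : ZMod p) - c * i)) *
          ∏ j ∈ Icc 1 n, ∏ i ∈ Icc 1 n, zeroToOne ((i : ZMod p) - c * j) := by
        rw [prod_comm (f := fun j i : ℕ => zeroToOne ((i : ZMod p) - c * j))]
        simp only [hT, sq, prod_mul_distrib]
      _ = (∏ j ∈ Icc 1 n, ∏ i ∈ Icc 1 n, c ^ (if -(i : ZMod p) - c * j = 0 then 0 else 1)) *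
          ∏ j ∈ Icc 1 n, ∏ i ∈ Icc 1 n,
            (zeroToOne ((i : ZMod p) - c * j) * zeroToOne (-(i : ZMod p) - c * j)) := by
        simp only [← prod_mul_distrib]
        refine prod_congr rfl fun j _ => prod_congr rfl fun i _ => ?_
        rw [show (j : ZMod p) - c * i = c * (-i - c * j) by linear_combination (j : ZMod p) * hc,
          zeroToOne_mul hc0]
        ring
      _ = _ := by
        simp only [prod_pow_eq_pow_sum, ← hNdef]
        congr 1
        exact prod_congr rfl fun j _ =>
          ZMod.prod_Icc_half_mul_neg hodd (fun x => zeroToOne (x - c * (j : ZMod p)))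
  have hinv : (∏ j ∈ Icc 1 n, ∏ x ∈ univ.erase (0 : ZMod p), zeroToOne (x - c * j)) *
      (c ^ n * n.factorial) = 1 := by
    have : c ^ n * (n.factorial : ZMod p) = ∏ j ∈ Icc 1 n, c * (j : ZMod p) := by
      rw [prod_mul_distrib, ← Nat.cast_prod, Nat.prod_Icc_one_id_eq_factorial]
      simp
    rw [this, ← prod_mul_distrib]
    exact prod_eq_one fun j hj => ZMod.prod_erase_zero_zeroToOne_sub
      (mul_ne_zero hc0 (ZMod.natCast_ne_zero_of_mem_Icc_half hj))
  have hc4 : c ^ 4 = 1 := by linear_combination (c ^ 2 - 1) * hc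
  have hcm : c ^ (4 * m) = 1 := by rw [pow_mul, hc4, one_pow]
  have hcN : c ^ N * c ^ m = 1 := by
    rw [← pow_add, show N + m = 4 * m * m by
      have : M = m := by omega
      rw [this, hm2] at hMN
      linarith, pow_mul, hcm, one_pow]
  have hcn : c ^ n * c ^ m * c ^ m = 1 := by
    rw [← pow_add, ← pow_add, show n + m + m = 4 * m by omega, hcm]
  rw [hfactor]
  set P := ∏ j ∈ Icc 1 n, ∏ x ∈ univ.erase (0 : ZMod p), zeroToOne (x - c * j)
  set u := c ^ m
  set F := (n.factorial : ZMod p)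
  calc
    c ^ N * P = -(c ^ N * P) * (c ^ n * u * u) * F ^ 2 := by rw [hcn, hfac]; ring
    _ = -((c ^ N * u) * (P * (c ^ n * F)) * u * F) := by ring
    _ = -u * F := by rw [hcN, hinv]; ring

end


/-- Theorem 1.4(i): let `p` be an odd prime and `A` an integer with `p ∣ A² + 4`, and let
`T_p(1,-A,-1) = ∏_{1 ≤ i,j ≤ (p-1)/2, p ∤ i²-Aij-j²} (i² - Aij - j²)`.
Then `p ≡ 1 (mod 4)`, `A ≡ 2(-1)^k ((p-1)/2)! (mod p)` for some `k ∈ {0,1}`, and: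
if `p ≡ 1 (mod 8)` then `T_p(1,-A,-1) ≡ (-1)^{(p+7)/8} ((p-1)/2)! (mod p)`;
if `p ≡ 5 (mod 8)` and `A ≡ 2(-1)^k ((p-1)/2)! (mod p)` with `k ∈ {0,1}`, then
`T_p(1,-A,-1) ≡ (-1)^{k+(p-5)/8} (mod p)`. -/
theorem statement11 (p : ℕ) [Fact p.Prime] (hodd : Odd p) (A : ℤ)
    (hA : (p : ℤ) ∣ A ^ 2 + 4) :
    p % 4 = 1 ∧
    (∃ k : ℕ, (k = 0 ∨ k = 1) ∧
      A ≡ 2 * (-1) ^ k * (Nat.factorial ((p - 1) / 2) : ℤ) [ZMOD (p : ℤ)]) ∧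
    (p % 8 = 1 →
      (∏ i ∈ Finset.Icc 1 ((p - 1) / 2), ∏ j ∈ Finset.Icc 1 ((p - 1) / 2),
          if (p : ℤ) ∣ ((i : ℤ) ^ 2 - A * (i : ℤ) * (j : ℤ) - (j : ℤ) ^ 2) then 1
          else (i : ℤ) ^ 2 - A * (i : ℤ) * (j : ℤ) - (j : ℤ) ^ 2)
        ≡ (-1) ^ ((p + 7) / 8) * (Nat.factorial ((p - 1) / 2) : ℤ) [ZMOD (p : ℤ)]) ∧
    (∀ k : ℕ, (k = 0 ∨ k = 1) → p % 8 = 5 →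
      A ≡ 2 * (-1) ^ k * (Nat.factorial ((p - 1) / 2) : ℤ) [ZMOD (p : ℤ)] →
      (∏ i ∈ Finset.Icc 1 ((p - 1) / 2), ∏ j ∈ Finset.Icc 1 ((p - 1) / 2),
          if (p : ℤ) ∣ ((i : ℤ) ^ 2 - A * (i : ℤ) * (j : ℤ) - (j : ℤ) ^ 2) then 1
          else (i : ℤ) ^ 2 - A * (i : ℤ) * (j : ℤ) - (j : ℤ) ^ 2)
        ≡ (-1) ^ (k + (p - 5) / 8) [ZMOD (p : ℤ)]) := by
  have h2 : (2 : ZMod p) ≠ 0 := by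
    intro h
    have h' : ((2 : ℕ) : ZMod p) = 0 := by exact_mod_cast h
    rw [ZMod.natCast_eq_zero_iff] at h'
    have := Nat.le_of_dvd (by norm_num) h'
    have := (Fact.out : p.Prime).two_le
    have := Nat.odd_iff.1 hodd
    omega
  obtain ⟨c, hAc⟩ : ∃ c : ZMod p, (A : ZMod p) = 2 * c := ⟨A / 2, by field_simp⟩
  have hc : c ^ 2 = -1 := by
    have h := (ZMod.intCast_zmod_eq_zero_iff_dvd _ p).2 hA
    push_cast at h
    rw [hAc] at h
    refine mul_left_cancel₀ (mul_ne_zero h2 h2) ?_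
    linear_combination h
  have hp4 : p % 4 = 1 := by
    have := ZMod.mod_four_ne_three_of_sq_eq_neg_one hc
    have := Nat.odd_iff.1 hodd
    omega
  have hfac := ZMod.half_factorial_sq hp4
  have hT : ((∏ i ∈ Finset.Icc 1 ((p - 1) / 2), ∏ j ∈ Finset.Icc 1 ((p - 1) / 2),
      if (p : ℤ) ∣ ((i : ℤ) ^ 2 - A * (i : ℤ) * (j : ℤ) - (j : ℤ) ^ 2) then 1
      else (i : ℤ) ^ 2 - A * (i : ℤ) * (j : ℤ) - (j : ℤ) ^ 2 : ℤ) : ZMod p) =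
      -c ^ ((p - 1) / 4) * ((p - 1) / 2).factorial := by
    rw [← ZMod.prod_zeroToOne_sub_sq hp4 hc, Int.cast_prod]
    refine Finset.prod_congr rfl fun i _ => ?_
    rw [Int.cast_prod]
    refine Finset.prod_congr rfl fun j _ => ?_
    have hq : (((i : ℤ) ^ 2 - A * (i : ℤ) * (j : ℤ) - (j : ℤ) ^ 2 : ℤ) : ZMod p) =
        ((i : ZMod p) - c * j) ^ 2 := by
      push_cast
      rw [hAc]
      linear_combination (-(j : ZMod p) ^ 2) * hc
    rw [← zeroToOne_sq, ← hq, zeroToOne]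
    simp only [ZMod.intCast_zmod_eq_zero_iff_dvd]
    split_ifs <;> simp
  refine ⟨hp4, ?_, ?_, ?_⟩
  · rcases sq_eq_sq_iff_eq_or_eq_neg.1 (hc.trans hfac.symm) with h | h
    · refine ⟨0, Or.inl rfl, ?_⟩
      rw [← ZMod.intCast_eq_intCast_iff]
      push_cast
      rw [hAc, h]
    · refine ⟨1, Or.inr rfl, ?_⟩
      rw [← ZMod.intCast_eq_intCast_iff]
      push_cast
      rw [hAc, h]
      ring
  · intro h8
    rw [← ZMod.intCast_eq_intCast_iff, hT]
    push_cast
    rw [show (p - 1) / 4 = 2 * ((p - 1) / 8) by omega, pow_mul, hc,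
      show (p + 7) / 8 = (p - 1) / 8 + 1 by omega, pow_succ]
    ring
  · intro k _ h8 hk
    rw [← ZMod.intCast_eq_intCast_iff] at hk ⊢
    rw [hT]
    push_cast at hk ⊢
    have hck : c = (-1) ^ k * ((p - 1) / 2).factorial := by
      refine mul_left_cancel₀ h2 ?_
      rw [← hAc, hk, mul_assoc]
    rw [show (p - 1) / 4 = 2 * ((p - 5) / 8) + 1 by omega, pow_succ, pow_mul, hc, pow_add]
    nth_rewrite 1 [hck]
    linear_combination (-(-1) ^ ((p - 5) / 8) * (-1) ^ k) * hfac
end
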